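/- Let v be even, n = v/2, let k be even with n ≥ k ≥ 4, and let h = k/2. Suppose there exists a resolvable (n, h, 2) covering design with p parallel classes, where p ≤ 5 and each parallel class consists of fewer than four blocks (i.e., n/h < 4). Then C(v, k, 4, 6) ≤ 2·C(v/2, k, 4, 5) + p·v²/k². -/

import Mathlib

/-- `(X, Bs)` is a `(|X|, k, t, m)` cover: `Bs` is a collection of `k`-subsets of `X` such that
every `m`-subset of `X` intersects at least one block of `Bs` in at least `t` points. -/
def IsCover {α : Type*} [DecidableEq α] (X : Finset α) (Bs : Finset (Finset α))
    (k t m : ℕ) : Prop :=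
  (∀ B ∈ Bs, B ⊆ X ∧ B.card = k) ∧
  ∀ M ⊆ X, M.card = m → ∃ B ∈ Bs, t ≤ (M ∩ B).card

/-- The cover number `C(v,k,t,m)`: the minimum number of blocks of a `(v,k,t,m)` cover.
The covering number `C(v,k,t)` is `C(v,k,t,t)`. -/
noncomputable def coverNumber (v k t m : ℕ) : ℕ :=
  sInf { b | ∃ Bs : Finset (Finset (Fin v)),
    IsCover Finset.univ Bs k t m ∧ Bs.card = b }

theorem coverNumber_le_card {α : Type*} [Fintype α] [DecidableEq α] {v k t m : ℕ}
    (hα : Fintype.card α = v) {Bs : Finset (Finset α)} (hBs : IsCover Finset.univ Bs k t m) :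
    coverNumber v k t m ≤ Bs.card := by
  let e : α ≃ Fin v := Fintype.equivFinOfCardEq hα
  refine Nat.sInf_le ⟨Bs.map (Finset.mapEmbedding e.toEmbedding).toEmbedding, ⟨?_, ?_⟩, by simp⟩
  · intro B hB
    obtain ⟨A, hA, rfl⟩ := Finset.mem_map.1 hB
    exact ⟨Finset.subset_univ _, by simpa using (hBs.1 A hA).2⟩
  · intro M _ hM
    obtain ⟨A, hA, hcard⟩ := hBs.2 (M.map e.symm.toEmbedding) (Finset.subset_univ _) (by simpa)
    refine ⟨_, Finset.mem_map_of_mem _ hA, hcard.trans_eq ?_⟩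
    rw [← Finset.card_map e.toEmbedding, Finset.map_inter, Finset.map_map]
    simp

theorem exists_isCover_card_eq_coverNumber {v k t m : ℕ} (hkv : k ≤ v) (htk : t ≤ k)
    (htm : t ≤ m) :
    ∃ Bs : Finset (Finset (Fin v)),
      IsCover Finset.univ Bs k t m ∧ Bs.card = coverNumber v k t m := by
  refine Nat.sInf_mem (s := { b | ∃ Bs : Finset (Finset (Fin v)),
    IsCover Finset.univ Bs k t m ∧ Bs.card = b })
    ⟨_, Finset.powersetCard k Finset.univ, ⟨?_, ?_⟩, rfl⟩
  · intro B hB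
    exact Finset.mem_powersetCard.1 hB
  · intro M _ hM
    obtain ⟨T, hTM, hT⟩ := Finset.exists_subset_card_eq (htm.trans_eq hM.symm)
    obtain ⟨B, hTB, -, hB⟩ := Finset.exists_subsuperset_card_eq (Finset.subset_univ T)
      (hT.trans_le htk) (by simpa using hkv)
    exact ⟨B, by simpa using hB, hT ▸ Finset.card_le_card (Finset.subset_inter hTM hTB)⟩

theorem IsCover.exists_le_card_inter {α : Type*} [DecidableEq α] {X : Finset α}
    {Bs : Finset (Finset α)} {k t m : ℕ} (hBs : IsCover X Bs k t m) {M : Finset α}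
    (hMX : M ⊆ X) (hM : m ≤ M.card) : ∃ B ∈ Bs, t ≤ (M ∩ B).card := by
  obtain ⟨T, hTM, hT⟩ := Finset.exists_subset_card_eq hM
  obtain ⟨B, hB, h⟩ := hBs.2 T (hTM.trans hMX) hT
  exact ⟨B, hB, h.trans (Finset.card_le_card (Finset.inter_subset_inter_right hTM))⟩

section ParallelClass

variable {α : Type*} [DecidableEq α]

theorem card_mul_of_parallelClass [Fintype α] {𝒞 : Finset (Finset α)} {h : ℕ}
    (hcard : ∀ B ∈ 𝒞, B.card = h) (hpart : ∀ x : α, ∃! B, B ∈ 𝒞 ∧ x ∈ B) :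
    𝒞.card * h = Fintype.card α := by
  have hunion : 𝒞.biUnion id = Finset.univ := by
    ext x
    obtain ⟨B, hB, -⟩ := hpart x
    simpa using ⟨B, hB⟩
  rw [← Finset.card_univ, ← hunion, Finset.card_biUnion]
  · exact (Finset.sum_const_nat hcard).symm
  intro A hA B hB hAB
  refine Finset.disjoint_left.2 fun x hxA hxB => hAB ?_
  exact (hpart x).unique ⟨hA, hxA⟩ ⟨hB, hxB⟩

theorem exists_two_le_card_inter_of_card_lt {𝒞 : Finset (Finset α)}
    (hpart : ∀ x : α, ∃! B, B ∈ 𝒞 ∧ x ∈ B) {M : Finset α} (hM : 𝒞.card < M.card) :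
    ∃ B ∈ 𝒞, 2 ≤ (M ∩ B).card := by
  choose f hf _ using hpart
  obtain ⟨x, hx, y, hy, hxy, hfxy⟩ :=
    Finset.exists_ne_map_eq_of_card_lt_of_maps_to hM (f := f) fun x _ => (hf x).1
  refine ⟨f x, (hf x).1, Finset.one_lt_card.2 ⟨x, ?_, y, ?_, hxy⟩⟩
  · exact Finset.mem_inter.2 ⟨hx, (hf x).2⟩
  · exact Finset.mem_inter.2 ⟨hy, hfxy ▸ (hf y).2⟩

theorem exists_subset_or_three_le_card_filter [Fintype α] {ι : Type*} [Fintype ι] [DecidableEq ι]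
    {P : ι → Finset (Finset α)} {h : ℕ}
    (hpart : ∀ i, ∀ x : α, ∃! B, B ∈ P i ∧ x ∈ B)
    (hcov : IsCover Finset.univ (Finset.univ.biUnion P) h 2 2)
    {M : Finset α} (hM : M.card = 3) :
    (∃ i, ∃ B ∈ P i, M ⊆ B) ∨
      3 ≤ (Finset.univ.filter fun i => ∃ B ∈ P i, 2 ≤ (M ∩ B).card).card := by
  have hpair : ∀ x y, x ≠ y → ∃ i, ∃ B ∈ P i, x ∈ B ∧ y ∈ B := by
    intro x y hxy
    obtain ⟨B, hB, hle⟩ := hcov.2 {x, y} (Finset.subset_univ _) (Finset.card_pair hxy)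
    obtain ⟨i, -, hi⟩ := Finset.mem_biUnion.1 hB
    have hsub : ({x, y} : Finset α) ⊆ B := Finset.inter_eq_left.1 <|
      Finset.eq_of_subset_of_card_le Finset.inter_subset_left
        (by rwa [Finset.card_pair hxy])
    exact ⟨i, B, hi, hsub (by simp), hsub (by simp)⟩
  rw [or_iff_not_imp_left]
  intro hnot
  obtain ⟨a, b, c, hab, hac, hbc, rfl⟩ := Finset.card_eq_three.1 hM
  have hnot' : ∀ i, ∀ B ∈ P i, a ∈ B → b ∈ B → c ∈ B → False := by
    intro i B hB ha hb hc
    refine hnot ⟨i, B, hB, ?_⟩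
    simp [Finset.insert_subset_iff, ha, hb, hc]
  obtain ⟨i, A, hA, haA, hbA⟩ := hpair a b hab
  obtain ⟨j, B, hB, haB, hcB⟩ := hpair a c hac
  obtain ⟨l, C, hC, hbC, hcC⟩ := hpair b c hbc
  have hij : i ≠ j := by
    rintro rfl
    obtain rfl := (hpart i a).unique ⟨hA, haA⟩ ⟨hB, haB⟩
    exact hnot' i A hA haA hbA hcB
  have hil : i ≠ l := by
    rintro rfl
    obtain rfl := (hpart i b).unique ⟨hA, hbA⟩ ⟨hC, hbC⟩
    exact hnot' i A hA haA hbA hcC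
  have hjl : j ≠ l := by
    rintro rfl
    obtain rfl := (hpart j c).unique ⟨hB, hcB⟩ ⟨hC, hcC⟩
    exact hnot' j B hB haB hbC hcB
  rw [← Finset.card_eq_three.2 ⟨i, j, l, hij, hil, hjl, rfl⟩]
  refine Finset.card_le_card fun x hx => Finset.mem_filter.2 ⟨Finset.mem_univ _, ?_⟩
  simp only [Finset.mem_insert, Finset.mem_singleton] at hx
  rcases hx with rfl | rfl | rfl
  · exact ⟨A, hA, Finset.one_lt_card.2 ⟨a, by simp [haA], b, by simp [hbA], hab⟩⟩
  · exact ⟨B, hB, Finset.one_lt_card.2 ⟨a, by simp [haB], c, by simp [hcB], hac⟩⟩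
  · exact ⟨C, hC, Finset.one_lt_card.2 ⟨b, by simp [hbC], c, by simp [hcC], hbc⟩⟩

/-- A set split into parts `M` and `N` of sizes at least two and total size six meets some
product block of a common parallel class in at least four points. -/
theorem exists_four_le_card_inter_add_card_inter [Fintype α] {ι : Type*} [Fintype ι]
    {P : ι → Finset (Finset α)} {h : ℕ} (hι : Fintype.card ι ≤ 5)
    (hpart : ∀ i, ∀ x : α, ∃! B, B ∈ P i ∧ x ∈ B) (hlt : ∀ i, (P i).card < 4)
    (hcov : IsCover Finset.univ (Finset.univ.biUnion P) h 2 2)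
    {M N : Finset α} (hM : 2 ≤ M.card) (hN : 2 ≤ N.card) (hMN : M.card + N.card = 6) :
    ∃ i, ∃ A ∈ P i, ∃ B ∈ P i, 4 ≤ (M ∩ A).card + (N ∩ B).card := by
  classical
  have hpair : ∀ L : Finset α, 2 ≤ L.card → ∃ i, ∃ B ∈ P i, 2 ≤ (L ∩ B).card := by
    intro L hL
    obtain ⟨B, hB, hle⟩ := hcov.exists_le_card_inter (Finset.subset_univ L) hL
    obtain ⟨i, -, hi⟩ := Finset.mem_biUnion.1 hB
    exact ⟨i, B, hi, hle⟩
  have hone : ∀ i, ∀ L : Finset α, 2 ≤ L.card → ∃ B ∈ P i, 1 ≤ (L ∩ B).card := by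
    intro i L hL
    obtain ⟨x, hx⟩ := Finset.card_pos.1 (by omega : 0 < L.card)
    obtain ⟨B, ⟨hB, hxB⟩, -⟩ := hpart i x
    exact ⟨B, hB, Finset.card_pos.2 ⟨x, Finset.mem_inter.2 ⟨hx, hxB⟩⟩⟩
  obtain hM4 | hN4 | ⟨hM3, hN3⟩ :
      4 ≤ M.card ∨ 4 ≤ N.card ∨ (M.card = 3 ∧ N.card = 3) := by omega
  · obtain ⟨i, B, hB, hNB⟩ := hpair N hN
    obtain ⟨A, hA, hMA⟩ :=
      exists_two_le_card_inter_of_card_lt (hpart i) ((hlt i).trans_le hM4)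
    exact ⟨i, A, hA, B, hB, by omega⟩
  · obtain ⟨i, A, hA, hMA⟩ := hpair M hM
    obtain ⟨B, hB, hNB⟩ :=
      exists_two_le_card_inter_of_card_lt (hpart i) ((hlt i).trans_le hN4)
    exact ⟨i, A, hA, B, hB, by omega⟩
  · obtain ⟨i, A, hA, hMA⟩ | hMcard := exists_subset_or_three_le_card_filter hpart hcov hM3
    · obtain ⟨B, hB, hNB⟩ := hone i N hN
      exact ⟨i, A, hA, B, hB, by rw [Finset.inter_eq_left.2 hMA]; omega⟩
    obtain ⟨i, B, hB, hNB⟩ | hNcard := exists_subset_or_three_le_card_filter hpart hcov hN3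
    · obtain ⟨A, hA, hMA⟩ := hone i M hM
      exact ⟨i, A, hA, B, hB, by rw [Finset.inter_eq_left.2 hNB]; omega⟩
    obtain ⟨i, hi⟩ := Finset.inter_nonempty_of_card_lt_card_add_card
      (Finset.subset_univ _) (Finset.subset_univ _)
      (Finset.card_univ.trans_lt (by omega) |>.trans_le (Nat.add_le_add hMcard hNcard))
    simp only [Finset.mem_inter, Finset.mem_filter, Finset.mem_univ, true_and] at hi
    obtain ⟨⟨A, hA, hMA⟩, B, hB, hNB⟩ := hi
    exact ⟨i, A, hA, B, hB, by omega⟩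

end ParallelClass

theorem card_inter_disjSum {α β : Type*} [DecidableEq α] [DecidableEq β] (M : Finset (α ⊕ β))
    (A : Finset α) (B : Finset β) :
    (M ∩ A.disjSum B).card = (M.toLeft ∩ A).card + (M.toRight ∩ B).card := by
  rw [← Finset.card_toLeft_add_card_toRight, Finset.toLeft_inter, Finset.toRight_inter,
    Finset.toLeft_disjSum, Finset.toRight_disjSum]

/-- If there is a resolvable `(n,h,2)` covering design with `p ≤ 5` parallel classes,
each consisting of fewer than four blocks (i.e. `n/h < 4`), where `n = v/2`, `h = k/2`,
`v, k` even and `n ≥ k ≥ 4`, then `C(v,k,4,6) ≤ 2C(v/2,k,4,5) + pv²/k²`. -/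
theorem bound_k46_improved (v n k h p : ℕ) (hv : Even v) (hn : n = v / 2) (hkeven : Even k)
    (hk4 : 4 ≤ k) (hkn : k ≤ n) (hh : h = k / 2) (hp : p ≤ 5) (hq : n / h < 4)
    (hres : ∃ P : Fin p → Finset (Finset (Fin n)),
      (∀ i, ∀ B ∈ P i, (B : Finset (Fin n)).card = h) ∧
      (∀ i, ∀ x : Fin n, ∃! B, B ∈ P i ∧ x ∈ B) ∧
      (∀ i, (P i).card < 4) ∧
      IsCover Finset.univ (Finset.univ.biUnion P) h 2 2) :
    coverNumber v k 4 6 ≤ 2 * coverNumber (v / 2) k 4 5 + p * v ^ 2 / k ^ 2 := by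
  obtain ⟨P, hcard, hpart, hlt, hcov⟩ := hres
  obtain ⟨Bs, hBs, hBscard⟩ := exists_isCover_card_eq_coverNumber (m := 5) hkn hk4 (by norm_num)
  have hkh : k = h + h := by obtain ⟨r, rfl⟩ := hkeven; omega
  have hvn : v = n + n := by obtain ⟨r, rfl⟩ := hv; omega
  let L : Finset (Finset (Fin n ⊕ Fin n)) := Bs.image fun B => B.disjSum ∅
  let R : Finset (Finset (Fin n ⊕ Fin n)) := Bs.image fun B => (∅ : Finset (Fin n)).disjSum B
  let Q : Finset (Finset (Fin n ⊕ Fin n)) :=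
    Finset.univ.biUnion fun i => (P i ×ˢ P i).image fun S => S.1.disjSum S.2
  have hcover : IsCover Finset.univ (L ∪ R ∪ Q) k 4 6 := by
    refine ⟨fun B hB => ⟨Finset.subset_univ _, ?_⟩, fun M _ hM => ?_⟩
    · simp only [L, R, Q, Finset.mem_union, Finset.mem_image, Finset.mem_biUnion,
        Finset.mem_product] at hB
      obtain (⟨A, hA, rfl⟩ | ⟨A, hA, rfl⟩) | ⟨i, -, S, hS, rfl⟩ := hB
      · simp [(hBs.1 A hA).2]
      · simp [(hBs.1 A hA).2]
      · rw [Finset.card_disjSum, hcard i _ hS.1, hcard i _ hS.2, hkh]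
    · have hsum := M.card_toLeft_add_card_toRight
      rw [hM] at hsum
      obtain hl | hr | ⟨hl, hr⟩ : 5 ≤ M.toLeft.card ∨ 5 ≤ M.toRight.card ∨
          (2 ≤ M.toLeft.card ∧ 2 ≤ M.toRight.card) := by omega
      · obtain ⟨B, hB, hle⟩ := hBs.exists_le_card_inter (Finset.subset_univ _) hl
        refine ⟨B.disjSum ∅, ?_, by rw [card_inter_disjSum]; omega⟩
        exact Finset.mem_union_left _ (Finset.mem_union_left _ (Finset.mem_image_of_mem _ hB))
      · obtain ⟨B, hB, hle⟩ := hBs.exists_le_card_inter (Finset.subset_univ _) hr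
        refine ⟨(∅ : Finset (Fin n)).disjSum B, ?_, by rw [card_inter_disjSum]; omega⟩
        exact Finset.mem_union_left _ (Finset.mem_union_right _ (Finset.mem_image_of_mem _ hB))
      · obtain ⟨i, A, hA, B, hB, hle⟩ := exists_four_le_card_inter_add_card_inter
          (by simpa using hp) hpart hlt hcov hl hr hsum
        refine ⟨A.disjSum B, Finset.mem_union_right _ ?_, by rwa [card_inter_disjSum]⟩
        exact Finset.mem_biUnion.2 ⟨i, Finset.mem_univ _,
          Finset.mem_image.2 ⟨(A, B), Finset.mem_product.2 ⟨hA, hB⟩, rfl⟩⟩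
  have hQ : Q.card ≤ p * v ^ 2 / k ^ 2 := by
    have hQsum : Q.card ≤ ∑ i, (P i).card * (P i).card :=
      Finset.card_biUnion_le.trans <| Finset.sum_le_sum fun i _ =>
        Finset.card_image_le.trans_eq (Finset.card_product _ _)
    rw [Nat.le_div_iff_mul_le (by positivity)]
    calc Q.card * k ^ 2 ≤ (∑ i, (P i).card * (P i).card) * k ^ 2 := Nat.mul_le_mul_right _ hQsum
      _ = ∑ _i : Fin p, v ^ 2 := by
        rw [Finset.sum_mul]
        refine Finset.sum_congr rfl fun i _ => ?_
        have hi := card_mul_of_parallelClass (hcard i) (hpart i)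
        rw [Fintype.card_fin] at hi
        have hvi : v = (P i).card * h + (P i).card * h := by rw [hi, hvn]
        rw [hvi, hkh]
        ring
      _ = p * v ^ 2 := by simp
  have hL : L.card ≤ Bs.card := Finset.card_image_le
  have hR : R.card ≤ Bs.card := Finset.card_image_le
  have hLR : (L ∪ R).card ≤ L.card + R.card := Finset.card_union_le _ _
  have hLRQ : (L ∪ R ∪ Q).card ≤ (L ∪ R).card + Q.card := Finset.card_union_le _ _
  have hle := coverNumber_le_card (v := v) (by simp [hvn]) hcover
  rw [← hn, ← hBscard]
  omega
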